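/- arXiv:2504.19727 — 2 statements merged into one kernel-verified Lean document; each statement's English description precedes it below -/
import Mathlib

section
/- For every natural number n > 2, o3(n + 2) + o3(n - 1) = pod(n). -/
/-- `pod n` is the number of partitions of `n` in which every odd part
appears at most once. -/
noncomputable def pod (n : ℕ) : ℕ :=
  Nat.card {p : n.Partition // ∀ a : ℕ, Odd a → p.parts.count a ≤ 1}

/-- `o3 n` is the number of partitions of `n` in which every odd part
appears at most once, the largest part is even, and the largest part
appears exactly once (the empty partition is counted). -/
noncomputable def o3 (n : ℕ) : ℕ :=
  Nat.card {p : n.Partition //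
    (∀ a : ℕ, Odd a → p.parts.count a ≤ 1) ∧ Even p.parts.sup ∧
      (p.parts = 0 ∨ p.parts.count p.parts.sup = 1)}

/-- A multiset of positive integers in which every odd number appears at most once. -/
def OddDistinct (s : Multiset ℕ) : Prop :=
  (∀ x ∈ s, 0 < x) ∧ ∀ a : ℕ, Odd a → s.count a ≤ 1

/-- A partition of `n` with distinct odd parts whose largest part is even and not repeated,
split into its largest part and the multiset of the other parts. -/
@[ext]
structure SplitPartition (n : ℕ) where
  top : ℕ
  rest : Multiset ℕ
  top_pos : 0 < top
  even_top : Even top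
  rest_lt : ∀ x ∈ rest, x < top
  oddDistinct : OddDistinct rest
  sum_eq : top + rest.sum = n

theorem Multiset.sup_cons_of_forall_lt {M : ℕ} {r : Multiset ℕ} (h : ∀ x ∈ r, x < M) :
    (M ::ₘ r).sup = M := by
  rw [Multiset.sup_cons, sup_eq_left]
  exact Multiset.sup_le.2 fun x hx => (h x hx).le

theorem Multiset.sup_mem_of_ne_zero {s : Multiset ℕ} (h : s ≠ 0) : s.sup ∈ s := by
  induction s using Multiset.induction with
  | empty => exact absurd rfl h
  | cons a s ih =>
    rw [Multiset.sup_cons]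
    rcases eq_or_ne s 0 with rfl | hs
    · simp
    · rcases le_total a s.sup with h1 | h1
      · rw [sup_eq_right.2 h1]
        exact Multiset.mem_cons_of_mem (ih hs)
      · rw [sup_eq_left.2 h1]
        exact Multiset.mem_cons_self a s

theorem OddDistinct.of_le {s t : Multiset ℕ} (ht : OddDistinct t) (h : s ≤ t) :
    OddDistinct s :=
  ⟨fun x hx => ht.1 x (Multiset.mem_of_le h hx),
    fun a ha => (Multiset.count_le_of_le a h).trans (ht.2 a ha)⟩

theorem OddDistinct.cons {s : Multiset ℕ} (hs : OddDistinct s) {a : ℕ} (ha : 0 < a)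
    (h : Even a ∨ a ∉ s) : OddDistinct (a ::ₘ s) := by
  refine ⟨fun x hx => ?_, fun b hb => ?_⟩
  · rcases Multiset.mem_cons.1 hx with rfl | hx
    exacts [ha, hs.1 x hx]
  · rw [Multiset.count_cons]
    split_ifs with hab
    · subst hab
      rcases h with h | h
      · exact absurd h (Nat.not_even_iff_odd.2 hb)
      · rw [Multiset.count_eq_zero_of_notMem h]
    · exact hs.2 b hb

theorem OddDistinct.notMem_of_cons {s : Multiset ℕ} {a : ℕ} (hs : OddDistinct (a ::ₘ s))
    (ha : Odd a) : a ∉ s := fun h => by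
  have h1 := hs.2 a ha
  rw [Multiset.count_cons_self] at h1
  have := Multiset.count_pos.2 h
  omega

theorem pod_eq_card (n : ℕ) :
    pod n = Nat.card {s : Multiset ℕ // OddDistinct s ∧ s.sum = n} :=
  Nat.card_congr
    { toFun := fun p => ⟨p.1.parts, ⟨fun _ hx => p.1.parts_pos hx, p.2⟩, p.1.parts_sum⟩
      invFun := fun s => ⟨⟨s.1, fun {x} hx => s.2.1.1 x hx, s.2.2⟩, s.2.1.2⟩
      left_inv := fun _ => rfl
      right_inv := fun _ => rfl }

/-- The underlying partition of a split partition. -/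
def SplitPartition.toPartition {n : ℕ} (q : SplitPartition n) : n.Partition where
  parts := q.top ::ₘ q.rest
  parts_pos {x} hx := (q.oddDistinct.cons q.top_pos (Or.inl q.even_top)).1 x hx
  parts_sum := by rw [Multiset.sum_cons, q.sum_eq]

theorem SplitPartition.toPartition_injective (n : ℕ) :
    Function.Injective (SplitPartition.toPartition (n := n)) := fun q q' h => by
  have h1 : q.top ::ₘ q.rest = q'.top ::ₘ q'.rest := congrArg Nat.Partition.parts h
  have h2 : q.top = q'.top := by
    rw [← Multiset.sup_cons_of_forall_lt q.rest_lt, h1,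
      Multiset.sup_cons_of_forall_lt q'.rest_lt]
  rw [h2] at h1
  exact SplitPartition.ext h2 ((Multiset.cons_inj_right _).1 h1)

instance (n : ℕ) : Finite (SplitPartition n) :=
  Finite.of_injective _ (SplitPartition.toPartition_injective n)

theorem o3_eq_card {n : ℕ} (hn : 0 < n) : o3 n = Nat.card (SplitPartition n) := by
  symm
  refine Nat.card_congr (Equiv.ofBijective
    (fun q => ⟨q.toPartition, (q.oddDistinct.cons q.top_pos (Or.inl q.even_top)).2, ?_, ?_⟩)
    ⟨fun q q' h => SplitPartition.toPartition_injective n (congrArg Subtype.val h), ?_⟩)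
  · exact (Multiset.sup_cons_of_forall_lt q.rest_lt).symm ▸ q.even_top
  · right
    change (q.top ::ₘ q.rest).count (q.top ::ₘ q.rest).sup = 1
    rw [Multiset.sup_cons_of_forall_lt q.rest_lt, Multiset.count_cons_self,
      Multiset.count_eq_zero_of_notMem fun h => (q.rest_lt _ h).false]
  · rintro ⟨p, hodd, heven, hcount⟩
    have hp : p.parts ≠ 0 := fun h => by
      have := p.parts_sum
      rw [h, Multiset.sum_zero] at this
      omega
    have hcount := hcount.resolve_left hp
    have hmem := Multiset.sup_mem_of_ne_zero hp
    obtain ⟨r, hr⟩ := Multiset.exists_cons_of_mem hmem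
    have hdist : OddDistinct p.parts := ⟨fun _ hx => p.parts_pos hx, hodd⟩
    refine ⟨⟨p.parts.sup, r, p.parts_pos hmem, heven, fun x hx => ?_, ?_, ?_⟩, ?_⟩
    · have hx' : x ∈ p.parts := hr ▸ Multiset.mem_cons_of_mem hx
      refine lt_of_le_of_ne (Multiset.le_sup hx') fun hxe => ?_
      have h1 : Multiset.count p.parts.sup (p.parts.sup ::ₘ r) = 1 := hr ▸ hcount
      rw [Multiset.count_cons_self] at h1
      have := Multiset.count_pos.2 (hxe ▸ hx)
      omega
    · exact hdist.of_le (hr ▸ Multiset.le_cons_self r _)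
    · rw [← Multiset.sum_cons, ← hr, p.parts_sum]
    · exact Subtype.ext (Nat.Partition.ext hr.symm)

theorem SplitPartition.two_lt_top {n : ℕ} (hn : 2 < n) (q : SplitPartition (n + 2)) :
    2 < q.top := by
  by_contra! h
  have hone : ∀ x ∈ q.rest, x = 1 := fun x hx => by
    have := q.rest_lt x hx
    have := q.oddDistinct.1 x hx
    omega
  have hrep := Multiset.eq_replicate_card.2 hone
  have hc := q.oddDistinct.2 1 odd_one
  have hs := q.sum_eq
  rw [hrep, Multiset.count_replicate_self] at hc
  rw [hrep, Multiset.sum_replicate, smul_eq_mul] at hs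
  omega

/-- Decrease the largest part by two, respectively increase it by one. -/
def shiftTop {n : ℕ} (hn : 2 < n) :
    SplitPartition (n + 2) ⊕ SplitPartition (n - 1) →
      {s : Multiset ℕ // OddDistinct s ∧ s.sum = n}
  | .inl q => ⟨(q.top - 2) ::ₘ q.rest, by
      have h := q.two_lt_top hn
      refine ⟨q.oddDistinct.cons (by omega) (Or.inl ?_), ?_⟩
      · exact (Nat.even_sub h.le).2 (iff_of_true q.even_top even_two)
      · have := q.sum_eq
        rw [Multiset.sum_cons]
        omega⟩
  | .inr q => ⟨(q.top + 1) ::ₘ q.rest, by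
      refine ⟨q.oddDistinct.cons (by omega) (Or.inr fun h => ?_), ?_⟩
      · have := q.rest_lt _ h
        omega
      · have := q.sum_eq
        rw [Multiset.sum_cons]
        omega⟩

theorem Multiset.eq_or_mem_of_cons_eq_cons {a b : ℕ} {s t : Multiset ℕ}
    (h : a ::ₘ s = b ::ₘ t) : a = b ∨ (a ∈ t ∧ b ∈ s) := by
  rcases Multiset.mem_cons.1 (h ▸ Multiset.mem_cons_self a s) with h1 | h1
  · exact Or.inl h1
  · rcases Multiset.mem_cons.1 (h.symm ▸ Multiset.mem_cons_self b t) with h2 | h2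
    · exact Or.inl h2.symm
    · exact Or.inr ⟨h1, h2⟩

theorem shiftTop_inl_ne_inr {n : ℕ} (hn : 2 < n) (q : SplitPartition (n + 2))
    (q' : SplitPartition (n - 1)) : shiftTop hn (.inl q) ≠ shiftTop hn (.inr q') := fun h => by
  have h1 : (q.top - 2) ::ₘ q.rest = (q'.top + 1) ::ₘ q'.rest := congrArg Subtype.val h
  have h2 := q.two_lt_top hn
  obtain ⟨c, hc⟩ := q.even_top
  obtain ⟨d, hd⟩ := q'.even_top
  rcases Multiset.eq_or_mem_of_cons_eq_cons h1 with h3 | ⟨h3, h4⟩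
  · omega
  · have := q'.rest_lt _ h3
    have := q.rest_lt _ h4
    omega

theorem shiftTop_injective {n : ℕ} (hn : 2 < n) : Function.Injective (shiftTop hn) := by
  rintro (q | q) (q' | q') h
  · have h1 : (q.top - 2) ::ₘ q.rest = (q'.top - 2) ::ₘ q'.rest := congrArg Subtype.val h
    have h2 := q.two_lt_top hn
    have h2' := q'.two_lt_top hn
    have h5 : q.top = q'.top := by
      obtain ⟨c, hc⟩ := q.even_top
      obtain ⟨d, hd⟩ := q'.even_top
      rcases Multiset.eq_or_mem_of_cons_eq_cons h1 with h3 | ⟨h3, h4⟩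
      · omega
      · have := q'.rest_lt _ h3
        have := q.rest_lt _ h4
        omega
    rw [h5] at h1
    exact congrArg _ (SplitPartition.ext h5 ((Multiset.cons_inj_right _).1 h1))
  · exact absurd h (shiftTop_inl_ne_inr hn q q')
  · exact absurd h.symm (shiftTop_inl_ne_inr hn q' q)
  · have h1 : (q.top + 1) ::ₘ q.rest = (q'.top + 1) ::ₘ q'.rest := congrArg Subtype.val h
    have h5 : q.top = q'.top := by
      rcases Multiset.eq_or_mem_of_cons_eq_cons h1 with h3 | ⟨h3, h4⟩
      · omega
      · have := q'.rest_lt _ h3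
        have := q.rest_lt _ h4
        omega
    rw [h5] at h1
    exact congrArg _ (SplitPartition.ext h5 ((Multiset.cons_inj_right _).1 h1))

theorem shiftTop_surjective {n : ℕ} (hn : 2 < n) : Function.Surjective (shiftTop hn) := by
  rintro ⟨s, hs, hsum⟩
  have hs0 : s ≠ 0 := fun h => by
    rw [h, Multiset.sum_zero] at hsum
    omega
  obtain ⟨r, hr⟩ := Multiset.exists_cons_of_mem (Multiset.sup_mem_of_ne_zero hs0)
  have hle : ∀ x ∈ s, x ≤ s.sup := fun x hx => Multiset.le_sup hx
  have hpos := hs.1 _ (Multiset.sup_mem_of_ne_zero hs0)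
  generalize s.sup = m at hr hle hpos
  subst hr
  have hrd : OddDistinct r := hs.of_le (Multiset.le_cons_self r m)
  have hrle : ∀ x ∈ r, x ≤ m := fun x hx => hle x (Multiset.mem_cons_of_mem hx)
  rw [Multiset.sum_cons] at hsum
  rcases Nat.even_or_odd m with hm | hm
  · refine ⟨.inl ⟨m + 2, r, by omega, hm.add even_two, fun x hx => ?_, hrd, by omega⟩,
      Subtype.ext rfl⟩
    have := hrle x hx
    omega
  · have hmr := hs.notMem_of_cons hm
    have hlt : ∀ x ∈ r, x < m := fun x hx =>
      lt_of_le_of_ne (hrle x hx) fun h => hmr (h ▸ hx)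
    by_cases hmem : m - 1 ∈ r
    · obtain ⟨t, rfl⟩ := Multiset.exists_cons_of_mem hmem
      rw [Multiset.sum_cons] at hsum
      refine ⟨.inl ⟨m + 1, m ::ₘ t, by omega, hm.add_odd odd_one, fun x hx => ?_, ?_, ?_⟩,
        Subtype.ext ?_⟩
      · rcases Multiset.mem_cons.1 hx with rfl | hx
        · omega
        · have := hrle x (Multiset.mem_cons_of_mem hx)
          omega
      · exact hs.of_le (Multiset.cons_le_cons m (Multiset.le_cons_self t _))
      · rw [Multiset.sum_cons]
        omega
      · exact Multiset.cons_swap _ _ _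
    · have hm1 : m ≠ 1 := by
        rintro rfl
        have h0 : r = 0 := Multiset.eq_zero_of_forall_notMem fun x hx => by
          have := hlt x hx
          have := hrd.1 x hx
          omega
        rw [h0, Multiset.sum_zero] at hsum
        omega
      refine ⟨.inr ⟨m - 1, r, by omega, Nat.Odd.sub_odd hm odd_one, fun x hx => ?_, hrd, by omega⟩,
        Subtype.ext ?_⟩
      · have := hlt x hx
        have : x ≠ m - 1 := fun h => hmem (h ▸ hx)
        omega
      · change (m - 1 + 1) ::ₘ r = m ::ₘ r
        rw [Nat.sub_add_cancel hpos]

theorem o3_add_o3_eq_pod (n : ℕ) (hn : 2 < n) :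
    o3 (n + 2) + o3 (n - 1) = pod n := by
  rw [o3_eq_card (by omega), o3_eq_card (by omega), pod_eq_card, ← Nat.card_sum]
  exact Nat.card_congr (Equiv.ofBijective _ ⟨shiftTop_injective hn, shiftTop_surjective hn⟩)
end

section
/- For every complex number q with 0 < |q| < 1, \sum_{m=0}^{\infty} (-q; q^2)_{m+1} q^{2m} / (q^2; q^2)_m = (q^2; q^4)_{\infty} / ((1 + q^3) (q; q)_{\infty}), i.e. \sum_{m=0}^{\infty} \left( \prod_{j=0}^{m} (1 + q^{2j+1}) \right) q^{2m} / \prod_{j=0}^{m-1} (1 - q^{2j+2}) = \prod_{j=0}^{\infty} (1 - q^{4j+2}) / \left( (1 + q^3) \prod_{j=0}^{\infty} (1 - q^{j+1}) \right), where the series converges absolutely. -/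
theorem multipliable_one_add_mul_pow {q : ℂ} (hq : ‖q‖ < 1) (c : ℂ) {a b : ℕ} (ha : a ≠ 0) :
    Multipliable (fun j : ℕ => 1 + c * q ^ (a * j + b)) := by
  refine multipliable_one_add_of_summable ?_
  have h : ‖q ^ a‖ < 1 := by
    rw [norm_pow]; exact pow_lt_one₀ (norm_nonneg _) hq ha
  refine ((summable_geometric_of_lt_one (norm_nonneg _) h).mul_left (‖c‖ * ‖q ^ b‖)).congr ?_
  intro j
  simp only [norm_mul, norm_pow, pow_add, pow_mul]
  ring

theorem one_sub_pow_ne_zero {q : ℂ} (hq : ‖q‖ < 1) {n : ℕ} (hn : n ≠ 0) : 1 - q ^ n ≠ 0 := by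
  intro h
  have h1 : ‖q ^ n‖ < 1 := by
    rw [norm_pow]; exact pow_lt_one₀ (norm_nonneg _) hq hn
  rw [← sub_eq_zero.mp h, norm_one] at h1
  exact lt_irrefl _ h1

theorem one_add_pow_ne_zero {q : ℂ} (hq : ‖q‖ < 1) {n : ℕ} (hn : n ≠ 0) : 1 + q ^ n ≠ 0 := by
  intro h
  refine one_sub_pow_ne_zero hq (n := n * 2) (by positivity) ?_
  linear_combination (1 - q ^ n) * h

theorem multipliable_one_add_pow {q : ℂ} (hq : ‖q‖ < 1) {a : ℕ} (b : ℕ) (ha : a ≠ 0) :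
    Multipliable (fun j : ℕ => 1 + q ^ (a * j + b)) := by
  simpa using multipliable_one_add_mul_pow hq 1 ha

theorem multipliable_one_sub_pow {q : ℂ} (hq : ‖q‖ < 1) {a : ℕ} (b : ℕ) (ha : a ≠ 0) :
    Multipliable (fun j : ℕ => 1 - q ^ (a * j + b)) := by
  simpa [sub_eq_add_neg] using multipliable_one_add_mul_pow hq (-1) ha

theorem tprod_one_sub_pow_ne_zero {q : ℂ} (hq : ‖q‖ < 1) {a b : ℕ} (ha : a ≠ 0) (hb : b ≠ 0) :
    ∏' j : ℕ, (1 - q ^ (a * j + b)) ≠ 0 := by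
  simp only [sub_eq_add_neg]
  refine tprod_one_add_ne_zero_of_summable (f := fun j : ℕ => -q ^ (a * j + b)) ?_ ?_
  · intro j
    rw [← sub_eq_add_neg]
    exact one_sub_pow_ne_zero hq (by positivity)
  · have h : ‖q ^ a‖ < 1 := by
      rw [norm_pow]; exact pow_lt_one₀ (norm_nonneg _) hq ha
    refine ((summable_geometric_of_lt_one (norm_nonneg _) h).mul_left ‖q ^ b‖).congr ?_
    intro j
    simp only [norm_neg, norm_pow, norm_mul, pow_add, pow_mul]
    ring

theorem one_add_cube_mul_sum_range {q : ℂ} (hq : ‖q‖ < 1) (n : ℕ) :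
    (1 + q ^ 3) * ∑ m ∈ Finset.range n, (∏ j ∈ Finset.range (m + 1), (1 + q ^ (2 * j + 1))) *
        q ^ (2 * m) / ∏ j ∈ Finset.range m, (1 - q ^ (2 * j + 2)) =
      (1 - q ^ (2 * n)) * ((∏ j ∈ Finset.range (n + 1), (1 + q ^ (2 * j + 1))) /
        ∏ j ∈ Finset.range n, (1 - q ^ (2 * j + 2))) := by
  induction n with
  | zero => simp
  | succ n ih =>
    rw [Finset.sum_range_succ, mul_add, ih, Finset.prod_range_succ _ (n + 1),
      Finset.prod_range_succ (fun j => 1 - q ^ (2 * j + 2)) n]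
    have hD : ∏ j ∈ Finset.range n, (1 - q ^ (2 * j + 2)) ≠ 0 :=
      Finset.prod_ne_zero_iff.mpr fun j _ => one_sub_pow_ne_zero hq (by positivity)
    have hn : 1 - q ^ (2 * n + 2) ≠ 0 := one_sub_pow_ne_zero hq (by positivity)
    rw [show 2 * (n + 1) = 2 * n + 2 by ring]
    generalize ∏ j ∈ Finset.range n, (1 - q ^ (2 * j + 2)) = D at *
    generalize ∏ j ∈ Finset.range (n + 1), (1 + q ^ (2 * j + 1)) = P at *
    field_simp
    ring

open Filter Topology in
theorem lambda_identity (q : ℂ) (hq0 : 0 < ‖q‖) (hq : ‖q‖ < 1) :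
    Summable (fun m : ℕ =>
      ‖(∏ j ∈ Finset.range (m + 1), (1 + q ^ (2 * j + 1))) * q ^ (2 * m) /
        ∏ j ∈ Finset.range m, (1 - q ^ (2 * j + 2))‖) ∧
    ∑' m : ℕ, (∏ j ∈ Finset.range (m + 1), (1 + q ^ (2 * j + 1))) * q ^ (2 * m) /
        ∏ j ∈ Finset.range m, (1 - q ^ (2 * j + 2)) =
      (∏' j : ℕ, (1 - q ^ (4 * j + 2))) /
        ((1 + q ^ 3) * ∏' j : ℕ, (1 - q ^ (j + 1))) := by
  have hA := multipliable_one_add_pow hq 1 two_ne_zero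
  have hB := multipliable_one_sub_pow hq 2 two_ne_zero
  have hC := multipliable_one_sub_pow hq 1 two_ne_zero
  have hB0 := tprod_one_sub_pow_ne_zero hq two_ne_zero two_ne_zero
  have hC0 := tprod_one_sub_pow_ne_zero hq two_ne_zero one_ne_zero
  have h3 : 1 + q ^ 3 ≠ 0 := one_add_pow_ne_zero hq three_ne_zero
  have hlim := (hA.tendsto_prod_tprod_nat.comp (tendsto_add_atTop_nat 1)).div
    hB.tendsto_prod_tprod_nat hB0
  have hq2 : ‖q ^ 2‖ < 1 := by
    rw [norm_pow]; exact pow_lt_one₀ (norm_nonneg _) hq two_ne_zero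
  have hsum : Summable (fun m : ℕ =>
      ‖(∏ j ∈ Finset.range (m + 1), (1 + q ^ (2 * j + 1))) * q ^ (2 * m) /
        ∏ j ∈ Finset.range m, (1 - q ^ (2 * j + 2))‖) := by
    obtain ⟨K, hK⟩ := hlim.norm.bddAbove_range
    refine Summable.of_nonneg_of_le (fun _ => norm_nonneg _) (fun m => ?_)
      ((summable_geometric_of_lt_one (norm_nonneg _) hq2).mul_left K)
    rw [mul_div_right_comm, norm_mul, pow_mul, norm_pow (q ^ 2)]
    exact mul_le_mul_of_nonneg_right (hK ⟨m, rfl⟩) (by positivity)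
  refine ⟨hsum, ?_⟩
  have hpow : Tendsto (fun n : ℕ => 1 - q ^ (2 * n)) atTop (𝓝 1) := by
    simpa [pow_mul] using (tendsto_pow_atTop_nhds_zero_of_norm_lt_one hq2).const_sub 1
  have hkey := tendsto_nhds_unique
    ((hsum.of_norm.hasSum.tendsto_sum_nat.const_mul (1 + q ^ 3)).congr
      (one_add_cube_mul_sum_range hq)) (hpow.mul hlim)
  have hnum : ∏' j : ℕ, (1 - q ^ (4 * j + 2)) =
      (∏' j : ℕ, (1 + q ^ (2 * j + 1))) * ∏' j : ℕ, (1 - q ^ (2 * j + 1)) := by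
    rw [← hA.tprod_mul hC]
    exact tprod_congr fun j => by ring
  have hden : ∏' j : ℕ, (1 - q ^ (j + 1)) =
      (∏' j : ℕ, (1 - q ^ (2 * j + 1))) * ∏' j : ℕ, (1 - q ^ (2 * j + 2)) :=
    (tprod_even_mul_odd (f := fun j : ℕ => 1 - q ^ (j + 1)) hC hB).symm
  rw [hnum, hden, eq_div_iff (mul_ne_zero h3 (mul_ne_zero hC0 hB0))]
  rw [one_mul, eq_div_iff hB0] at hkey
  linear_combination (∏' j : ℕ, (1 - q ^ (2 * j + 1))) * hkey
end
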